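/- Let A be a unital C*-algebra such that for every nonzero projection e ∈ A the hereditary subalgebra eAe is infinite dimensional. Let b ∈ A be positive with ‖b‖ = 1 and let ε > 0. Then for every integer n ≥ 1 there exist positive elements b₁, …, bₙ ∈ A with ‖bⱼ‖ = 1, b bⱼ = bⱼ b, ‖b bⱼ‖ ≥ 1 − ε for all j, and bᵢ bⱼ = 0 whenever i ≠ j. -/

import Mathlib

/-- Every self-adjoint element lies in a maximal abelian `*`-subalgebra, which is closed. -/
theorem exists_maximal_abelian_starSubalgebra {A : Type*} [CStarAlgebra A] (b : A)
    (hb : IsSelfAdjoint b) :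
    ∃ C : StarSubalgebra ℂ A, b ∈ C ∧ IsClosed (C : Set A) ∧ (∀ x ∈ C, ∀ y ∈ C, x * y = y * x) ∧
      ∀ a, (∀ x ∈ C, x * a = a * x) → a ∈ C := by
  obtain ⟨S, hbS, hS⟩ := zorn_subset_nonempty
    {s : Set A | (∀ x ∈ s, IsSelfAdjoint x) ∧ ∀ x ∈ s, ∀ y ∈ s, x * y = y * x}
    (fun c hc hchain _ ↦ ⟨⋃₀ c, ⟨fun x ⟨s, hs, hx⟩ ↦ (hc hs).1 x hx, by
      rintro x ⟨s, hs, hx⟩ y ⟨t, ht, hy⟩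
      rcases hchain.total hs ht with h | h
      · exact (hc ht).2 x (h hx) y hy
      · exact (hc hs).2 x hx y (h hy)⟩, fun _ hs ↦ Set.subset_sUnion_of_mem hs⟩)
    {b} ⟨by simpa using hb, by simp⟩
  obtain ⟨⟨hsa, hcomm⟩, hmax⟩ := hS
  have mem_iff (a : A) : a ∈ StarSubalgebra.centralizer ℂ S ↔ ∀ x ∈ S, x * a = a * x := by
    rw [StarSubalgebra.mem_centralizer_iff]
    refine forall₂_congr fun x hx ↦ ?_
    rw [(hsa x hx).star_eq, and_self]
  have mem_of_isSelfAdjoint (a : A) (ha : IsSelfAdjoint a)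
      (h : a ∈ StarSubalgebra.centralizer ℂ S) : a ∈ S := by
    rw [mem_iff] at h
    refine hmax (y := insert a S) ⟨?_, ?_⟩ (Set.subset_insert a S) (Set.mem_insert a S)
    · rintro x (rfl | hx)
      exacts [ha, hsa x hx]
    · rintro x (rfl | hx) y (rfl | hy)
      exacts [rfl, (h y hy).symm, h x hx, hcomm x hx y hy]
  have comm_of_mem (x : A) (hx : x ∈ StarSubalgebra.centralizer ℂ S) (y : A) (hy : y ∈ S) :
      y * x = x * y := (mem_iff x).1 hx y hy
  refine ⟨StarSubalgebra.centralizer ℂ S, (mem_iff b).2 fun x hx ↦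
    hcomm x hx b (hbS rfl), Set.isClosed_centralizer _, fun x hx y hy ↦ ?_, fun a ha ↦
    (mem_iff a).2 fun x hx ↦ ha x ((mem_iff x).2 fun y hy ↦ hcomm y hy x hx)⟩
  have hre : (realPart x : A) ∈ S := by
    refine mem_of_isSelfAdjoint _ (realPart x).2 ?_
    rw [realPart_apply_coe]
    rw [← Complex.coe_smul]
    exact SMulMemClass.smul_mem _ (add_mem hx (star_mem hx))
  have him : (imaginaryPart x : A) ∈ S := by
    refine mem_of_isSelfAdjoint _ (imaginaryPart x).2 ?_
    rw [imaginaryPart_apply_coe, ← Complex.coe_smul]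
    exact SMulMemClass.smul_mem _ (SMulMemClass.smul_mem _ (sub_mem hx (star_mem hx)))
  rw [← realPart_add_I_smul_imaginaryPart x, add_mul, mul_add, smul_mul_assoc, mul_smul_comm,
    comm_of_mem y hy _ hre, comm_of_mem y hy _ him]

/-- In a compact Hausdorff space, a real-valued function of sup norm one that takes the value `1`
at `x` can be chosen to vanish outside a given open neighbourhood of `x`. -/
theorem exists_continuousMap_eq_one_of_mem_open {X : Type*} [TopologicalSpace X] [CompactSpace X]
    [T2Space X] {V : Set X} (hV : IsOpen V) {x : X} (hx : x ∈ V) :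
    ∃ f : C(X, ℂ), star f = f ∧ f x = 1 ∧ ‖f‖ = 1 ∧ ∀ y ∉ V, f y = 0 := by
  obtain ⟨g, hg0, hg1, hg⟩ := exists_continuous_zero_one_of_isClosed hV.isClosed_compl
    (isClosed_singleton (x := x)) (by simpa using hx)
  have hgx : g x = 1 := hg1 rfl
  refine ⟨(⟨Complex.ofReal, Complex.continuous_ofReal⟩ : C(ℝ, ℂ)).comp g, ?_, ?_, ?_, ?_⟩
  · ext y
    simp
  · simp [hgx]
  · refine le_antisymm ((ContinuousMap.norm_le _ zero_le_one).2 fun y ↦ ?_) ?_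
    · simpa [abs_le] using ⟨by linarith [(hg y).1], (hg y).2⟩
    · simpa [hgx] using ContinuousMap.norm_coe_le_norm
        ((⟨Complex.ofReal, Complex.continuous_ofReal⟩ : C(ℝ, ℂ)).comp g) x
  · intro y hy
    have : g y = 0 := hg0 hy
    simp [this]

/-- If no corner of `A` by a nonzero projection is finite dimensional, then the character space of
a maximal abelian `*`-subalgebra has no isolated points. -/
theorem not_isOpen_singleton_characterSpace {A : Type*} [CStarAlgebra A]
    (hinf : ∀ e : A, e ≠ 0 → IsIdempotentElem e → IsSelfAdjoint e →
      ¬ FiniteDimensional ℂ (Submodule.span ℂ {x : A | ∃ a : A, x = e * a * e}))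
    {B : Type*} [CommCStarAlgebra B] (ι : B →⋆ₐ[ℂ] A) (hι : Function.Injective ι)
    (hmax : ∀ a, (∀ x, ι x * a = a * ι x) → a ∈ Set.range ι)
    (χ : WeakDual.characterSpace ℂ B) : ¬ IsOpen {χ} := by
  intro hopen
  obtain ⟨f, hfstar, hf1, -, hf0⟩ := exists_continuousMap_eq_one_of_mem_open hopen rfl
  have mul_f (g : C(WeakDual.characterSpace ℂ B, ℂ)) : g * f = g χ • f := by
    ext ψ
    by_cases h : ψ = χ
    · simp [h]
    · simp [hf0 ψ h]
  set p : B := (gelfandStarTransform B).symm f with hp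
  have mul_p (x : B) : ∃ c : ℂ, x * p = c • p := by
    refine ⟨gelfandStarTransform B x χ, EquivLike.injective (gelfandStarTransform B) ?_⟩
    rw [map_mul, map_smul, hp, StarAlgEquiv.apply_symm_apply, mul_f]
  have p_mul_p : p * p = p := by
    rw [hp, ← map_mul, mul_f, hf1, one_smul]
  have p_ne : p ≠ 0 := by
    rintro h
    have : f = 0 := by
      rw [← (gelfandStarTransform B).apply_symm_apply f, ← hp, h, map_zero]
    simp [this] at hf1
  have idem : ι p * ι p = ι p := by rw [← map_mul, p_mul_p]
  refine hinf (ι p) (by rwa [Ne, map_eq_zero_iff ι hι]) idem ?_ ?_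
  · rw [IsSelfAdjoint, ← map_star, hp, ← map_star, hfstar]
  suffices h : Submodule.span ℂ {x : A | ∃ a : A, x = ι p * a * ι p} ≤ Submodule.span ℂ {ι p} from
    Submodule.finiteDimensional_of_le h
  rw [Submodule.span_le]
  rintro _ ⟨a, rfl⟩
  obtain ⟨x, hx⟩ := hmax (ι p * a * ι p) fun x ↦ by
    obtain ⟨c, hc⟩ := mul_p x
    have h1 : ι x * ι p = c • ι p := by rw [← map_mul, hc, map_smul]
    have h2 : ι p * ι x = c • ι p := by rw [← map_mul, mul_comm, hc, map_smul]
    rw [← mul_assoc, ← mul_assoc, h1, mul_assoc _ _ (ι x), h2, smul_mul_assoc, smul_mul_assoc,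
      mul_smul_comm]
  obtain ⟨c, hc⟩ := mul_p x
  refine Submodule.mem_span_singleton.2 ⟨c, ?_⟩
  rw [← map_smul, ← hc, map_mul, hx, mul_assoc, idem]

/-- If the character space of a unital commutative C⋆-algebra has no isolated points, then near
the maximum of `b` one can place any number of pairwise orthogonal norm-one elements. -/
theorem exists_orthogonal_of_not_isOpen_singleton {B : Type*} [CommCStarAlgebra B]
    [Nontrivial B] (hB : ∀ χ : WeakDual.characterSpace ℂ B, ¬ IsOpen {χ}) (b : B) {r : ℝ}
    (hr : r < ‖b‖) (n : ℕ) :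
    ∃ d : Fin n → B, (∀ j, star (d j) = d j) ∧ (∀ j, ‖d j‖ = 1) ∧
      (∀ j, r ≤ ‖b * (d j * d j)‖) ∧ ∀ i j, i ≠ j → d i * d j = 0 := by
  have norm_eq (x : B) : ‖gelfandStarTransform B x‖ = ‖x‖ :=
    (gelfandTransform_isometry B).norm_map_of_map_zero (map_zero _) x
  set g := gelfandStarTransform B b with hg
  obtain ⟨χ, hχ⟩ : ∃ χ, r < ‖g χ‖ := by
    by_contra! h
    exact hr.not_ge (by rw [← norm_eq, ContinuousMap.norm_le_of_nonempty]; exact h)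
  have hU : IsOpen {χ | r < ‖g χ‖} := isOpen_lt continuous_const (by fun_prop)
  have : (nhdsWithin χ {χ}ᶜ).NeBot := by
    rw [Filter.neBot_iff, Ne, ← isOpen_singleton_iff_punctured_nhds]
    exact hB χ
  have hUinf := infinite_of_mem_nhds χ (hU.mem_nhds hχ)
  obtain ⟨t, htU, htn⟩ := hUinf.exists_subset_card_eq n
  obtain ⟨V, hV, hdisj⟩ := t.finite_toSet.t2_separation
  let x := fun j ↦ (t.equivFinOfCardEq htn).symm j
  choose f hfstar hf1 hfn hf0 using fun j ↦
    exists_continuousMap_eq_one_of_mem_open (hV (x j)).2 (hV (x j)).1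
  have hd (j) : gelfandStarTransform B ((gelfandStarTransform B).symm (f j)) = f j :=
    (gelfandStarTransform B).apply_symm_apply _
  refine ⟨fun j ↦ (gelfandStarTransform B).symm (f j), fun j ↦ ?_, fun j ↦ ?_, fun j ↦ ?_,
    fun i j hij ↦ ?_⟩
  · rw [← map_star, hfstar]
  · rw [← norm_eq, hd, hfn]
  · rw [← norm_eq, map_mul, map_mul, hd]
    refine (show r < ‖g (x j)‖ from htU (x j).2).le.trans ?_
    simpa [hf1] using ContinuousMap.norm_coe_le_norm (g * (f j * f j)) (x j)
  · rw [← map_mul, EmbeddingLike.map_eq_zero_iff]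
    ext ψ
    have hxne : (x i : WeakDual.characterSpace ℂ B) ≠ x j := fun h ↦
      hij ((t.equivFinOfCardEq htn).symm.injective (Subtype.ext h))
    by_cases h : ψ ∈ V (x i)
    · have := hf0 j ψ fun h' ↦ (hdisj (x i).2 (x j).2 hxne).le_bot ⟨h, h'⟩
      simp [this]
    · simp [hf0 i ψ h]

theorem stmt7 {A : Type*} [CStarAlgebra A] [PartialOrder A] [StarOrderedRing A]
    (hinf : ∀ e : A, e ≠ 0 → IsIdempotentElem e → IsSelfAdjoint e →
      ¬ FiniteDimensional ℂ (Submodule.span ℂ {x : A | ∃ a : A, x = e * a * e}))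
    (b : A) (hb : 0 ≤ b) (hbn : ‖b‖ = 1) (ε : ℝ) (hε : 0 < ε) (n : ℕ) (hn : 1 ≤ n) :
    ∃ c : Fin n → A, (∀ j, 0 ≤ c j) ∧ (∀ j, ‖c j‖ = 1) ∧
      (∀ j, b * c j = c j * b) ∧ (∀ j, 1 - ε ≤ ‖b * c j‖) ∧
      (∀ i j, i ≠ j → c i * c j = 0) := by
  obtain ⟨C, hbC, hclosed, hcomm, hmax⟩ :=
    exists_maximal_abelian_starSubalgebra b (IsSelfAdjoint.of_nonneg hb)
  let : CommCStarAlgebra C :=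
    { StarSubalgebra.cstarAlgebra C (h_closed := hclosed) with
      mul_comm := fun x y ↦ Subtype.ext (hcomm x x.2 y y.2) }
  have : Nontrivial C := ⟨⟨b, hbC⟩, 0, fun h ↦ by
    simp [show b = 0 from congrArg Subtype.val h] at hbn⟩
  obtain ⟨d, hstar, hnorm, hle, horth⟩ := exists_orthogonal_of_not_isOpen_singleton
    (not_isOpen_singleton_characterSpace hinf C.subtype Subtype.val_injective fun a ha ↦
      ⟨⟨a, hmax a fun x hx ↦ ha ⟨x, hx⟩⟩, rfl⟩)
    (⟨b, hbC⟩ : C) (r := 1 - ε) (by change _ < ‖b‖; linarith) n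
  have hsq (j) : star (d j : A) * d j = (d j * d j : C) := by
    simpa using congrArg (Subtype.val) (congrArg (· * d j) (hstar j))
  refine ⟨fun j ↦ star (d j : A) * d j, fun j ↦ star_mul_self_nonneg _, fun j ↦ ?_, fun j ↦ ?_,
    fun j ↦ ?_, fun i j hij ↦ ?_⟩
  · rw [CStarRing.norm_star_mul_self, show ‖(d j : A)‖ = 1 from hnorm j, one_mul]
  · beta_reduce
    rw [hsq]
    exact hcomm b hbC _ (d j * d j).2
  · beta_reduce
    rw [hsq]
    exact hle j
  · beta_reduce
    rw [hsq, hsq]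
    have : d i * d i * (d j * d j) = 0 := by
      rw [mul_assoc, ← mul_assoc (d i) (d j), horth i j hij, zero_mul, mul_zero]
    exact congrArg Subtype.val this
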